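/- For every θ > 0 with θ ≠ 1, and every real t > m_θ := 1/(θ·e^{1/θ − 1} − 1), one has (−t^{-1} − 1)/(θ e^{1/θ}) > −1/e; conversely for 0 < t < m_θ the quantity is < −1/e. Moreover θ e^{1/θ} ≥ e for all θ > 0 with equality if and only if θ = 1 (so m_θ is well-defined and positive for θ ≠ 1). -/

import Mathlib

open Real Set

theorem one_lt_mul_exp_one_div_sub_one {x : ℝ} (hx : 0 < x) (hx1 : x ≠ 1) :
    1 < x * Real.exp (1 / x - 1) := by
  have hne : 1 / x - 1 ≠ 0 := by
    rw [sub_ne_zero, ne_eq, div_eq_one_iff_eq hx.ne']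
    exact hx1.symm
  have h := mul_lt_mul_of_pos_left (Real.add_one_lt_exp hne) hx
  rwa [sub_add_cancel, mul_one_div_cancel hx.ne'] at h

theorem mul_exp_one_div_eq (x : ℝ) :
    x * Real.exp (1 / x) = x * Real.exp (1 / x - 1) * Real.exp 1 := by
  rw [mul_assoc, ← Real.exp_add, sub_add_cancel]

theorem exp_one_lt_mul_exp_one_div {x : ℝ} (hx : 0 < x) (hx1 : x ≠ 1) :
    Real.exp 1 < x * Real.exp (1 / x) := by
  rw [mul_exp_one_div_eq]
  exact lt_mul_of_one_lt_left (Real.exp_pos 1) (one_lt_mul_exp_one_div_sub_one hx hx1)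

/-- For `θ > 0`, `θ ≠ 1`, and `m_θ = 1/(θ e^{1/θ−1} − 1)`: the quantity
`(−t⁻¹ − 1)/(θ e^{1/θ})` is `> −1/e` for `t > m_θ` and `< −1/e` for `0 < t < m_θ`;
moreover `θ' e^{1/θ'} ≥ e` for every `θ' > 0` with equality iff `θ' = 1`, and `m_θ > 0`. -/
theorem support_endpoint (θ : ℝ) (hθ : 0 < θ) (hθ1 : θ ≠ 1)
    (m : ℝ) (hm : m = 1 / (θ * Real.exp (1 / θ - 1) - 1)) :
    (∀ t : ℝ, m < t → -1 / Real.exp 1 < (-t⁻¹ - 1) / (θ * Real.exp (1 / θ))) ∧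
    (∀ t : ℝ, 0 < t → t < m → (-t⁻¹ - 1) / (θ * Real.exp (1 / θ)) < -1 / Real.exp 1) ∧
    (∀ θ' : ℝ, 0 < θ' →
      (Real.exp 1 ≤ θ' * Real.exp (1 / θ') ∧
        (θ' * Real.exp (1 / θ') = Real.exp 1 ↔ θ' = 1))) ∧
    0 < m := by
  have hA := one_lt_mul_exp_one_div_sub_one hθ hθ1
  rw [mul_exp_one_div_eq]
  set A := θ * Real.exp (1 / θ - 1)
  have hA0 : 0 < A := one_pos.trans hA
  have hm0 : 0 < m := hm ▸ one_div_pos.2 (sub_pos.2 hA)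
  have hminv : m⁻¹ = A - 1 := by rw [hm, one_div, inv_inv]
  have he := Real.exp_pos 1
  have hAe : -1 / Real.exp 1 = -A / (A * Real.exp 1) := by field_simp
  rw [hAe]
  refine ⟨fun t ht => ?_, fun t ht0 ht => ?_, fun x hx => ?_, hm0⟩
  · have := inv_strictAnti₀ hm0 ht
    exact div_lt_div_of_pos_right (by linarith) (mul_pos hA0 he)
  · have := inv_strictAnti₀ ht0 ht
    exact div_lt_div_of_pos_right (by linarith) (mul_pos hA0 he)
  · by_cases hx1 : x = 1
    · simp [hx1]
    · have h := exp_one_lt_mul_exp_one_div hx hx1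
      exact ⟨h.le, fun h' => absurd h' h.ne', fun h' => absurd h' hx1⟩
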